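/- arXiv:2201.08168 — 2 statements merged into one kernel-verified Lean document; each statement's English description precedes it below -/
import Mathlib

section
/- Fix an integer k ≥ 1 and let a_k(n) be defined by a_k(0) = 1 and a_k(n+1) = Σ_{0 ≤ i ≤ n, k | i} a_k(i)·a_k(n−i). Then for every fixed r ∈ {0, 1, …, k−1} and every m ≥ 1, a_k(km) = Σ_{j=0}^{m−1} a_k(kj + r)·a_k(k(m−j) − r − 1). -/
/-- In a sum over the multiples of `k` among `0, …, k * q + s` with `s < k`, these multiples are
`0, k, …, k * q`. -/
theorem sum_range_ite_dvd {M : Type*} [AddCommMonoid M] (f : ℕ → M) {k s : ℕ} (hs : s < k)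
    (q : ℕ) :
    (∑ i ∈ Finset.range (k * q + s + 1), if k ∣ i then f i else 0) =
      ∑ j ∈ Finset.range (q + 1), f (k * j) := by
  have hk : 0 < k := by omega
  rw [← Finset.sum_filter]
  symm
  refine Finset.sum_nbij (fun j => k * j) ?_ ?_ ?_ (fun _ _ => rfl)
  · intro j hj
    have h : k * j ≤ k * q := Nat.mul_le_mul_left k (by simpa [Nat.lt_succ_iff] using hj)
    simp only [Finset.mem_filter, Finset.mem_range, dvd_mul_right, and_true]
    omega
  · exact fun x _ y _ h => Nat.eq_of_mul_eq_mul_left hk h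
  · rintro _ hi
    obtain ⟨hi, j, rfl⟩ := by simpa using hi
    refine ⟨j, ?_, rfl⟩
    have h : k * j < k * (q + 1) := by rw [mul_add, mul_one]; omega
    simpa using Nat.lt_of_mul_lt_mul_left h

section

variable {k : ℕ} {a : ℕ → ℕ}

theorem coeff_mk_mul_mk (s q : ℕ) :
    PowerSeries.coeff q (PowerSeries.mk (fun j => a (k * j)) *
      PowerSeries.mk (fun j => a (k * j + s))) =
      ∑ j ∈ Finset.range (q + 1), a (k * j) * a (k * (q - j) + s) := by
  simp only [PowerSeries.coeff_mul, PowerSeries.coeff_mk]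
  exact Finset.Nat.sum_antidiagonal_eq_sum_range_succ (fun i j => a (k * i) * a (k * j + s)) q

theorem apply_mul_add_add_one
    (harec : ∀ n : ℕ,
      a (n + 1) = ∑ i ∈ Finset.range (n + 1), if k ∣ i then a i * a (n - i) else 0)
    {s : ℕ} (hs : s < k) (q : ℕ) :
    a (k * q + s + 1) = PowerSeries.coeff q (PowerSeries.mk (fun j => a (k * j)) *
      PowerSeries.mk (fun j => a (k * j + s))) := by
  rw [harec, sum_range_ite_dvd (fun i => a i * a (k * q + s - i)) hs, coeff_mk_mul_mk]
  refine Finset.sum_congr rfl fun j hj => ?_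
  have h : k * j ≤ k * q := Nat.mul_le_mul_left k (by simpa [Nat.lt_succ_iff] using hj)
  rw [Nat.mul_sub, Nat.sub_add_comm h]

/-- The generating function of the residue class `s` is a power of that of the class `0`. -/
theorem mk_mul_add_eq_pow
    (harec : ∀ n : ℕ,
      a (n + 1) = ∑ i ∈ Finset.range (n + 1), if k ∣ i then a i * a (n - i) else 0)
    {s : ℕ} (hs : s < k) :
    PowerSeries.mk (fun j => a (k * j + s)) = PowerSeries.mk (fun j => a (k * j)) ^ (s + 1) := by
  induction s with
  | zero => simp
  | succ s ih =>
    rw [pow_succ', ← ih (by omega)]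
    ext q
    rw [PowerSeries.coeff_mk, ← add_assoc, apply_mul_add_add_one harec (by omega)]

end

theorem fuss_catalan_another_recursion (k : ℕ) (hk : 1 ≤ k) (a : ℕ → ℕ) (ha0 : a 0 = 1)
    (harec : ∀ n : ℕ,
      a (n + 1) = ∑ i ∈ Finset.range (n + 1), if k ∣ i then a i * a (n - i) else 0)
    (r m : ℕ) (hr : r < k) (hm : 1 ≤ m) :
    a (k * m) = ∑ j ∈ Finset.range m, a (k * j + r) * a (k * (m - j) - r - 1) := by
  obtain ⟨q, rfl⟩ := Nat.exists_eq_add_of_le' hm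
  have hprod : PowerSeries.mk (fun j => a (k * j)) * PowerSeries.mk (fun j => a (k * j + (k - 1))) =
      PowerSeries.mk (fun j => a (k * j + r)) *
        PowerSeries.mk (fun j => a (k * j + (k - 1 - r))) := by
    rw [mk_mul_add_eq_pow harec hr, mk_mul_add_eq_pow harec (s := k - 1) (by omega),
      mk_mul_add_eq_pow harec (s := k - 1 - r) (by omega), ← pow_succ', ← pow_add]
    congr 1
    omega
  have hindex : k * (q + 1) = k * q + (k - 1) + 1 := by rw [mul_add, mul_one]; omega
  rw [hindex, apply_mul_add_add_one harec (by omega), hprod]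
  simp only [PowerSeries.coeff_mul, PowerSeries.coeff_mk]
  rw [Finset.Nat.sum_antidiagonal_eq_sum_range_succ
    (fun i j => a (k * i + r) * a (k * j + (k - 1 - r)))]
  refine Finset.sum_congr rfl fun j hj => ?_
  have hj' : j ≤ q := by simpa [Nat.lt_succ_iff] using hj
  have h : k * (q + 1 - j) - r - 1 = k * (q - j) + (k - 1 - r) := by
    rw [Nat.sub_add_comm hj', mul_add, mul_one]
    omega
  rw [h]
end

section
/- Let k ≥ 3, n ≥ 1, and r ∈ [k]. Then mp_{213}(n,k,r) = a_k(n) if r = 1 or k divides n, and mp_{213}(n,k,r) = 0 otherwise, where a_k(n) is defined by a_k(0) = 1 and a_k(n+1) = Σ_{0 ≤ i ≤ n, k | i} a_k(i)·a_k(n−i). -/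
open Finset

/-- A permutation `π` of `Fin n` contains the length-3 pattern `σ`
(given as a permutation of `Fin 3`, read as the word `σ 0, σ 1, σ 2`). -/
def Pattern3 {n : ℕ} (σ : Equiv.Perm (Fin 3)) (π : Equiv.Perm (Fin n)) : Prop :=
  ∃ f : Fin 3 → Fin n, StrictMono f ∧ ∀ a b : Fin 3, σ a < σ b ↔ π (f a) < π (f b)

/-- The pattern 123. -/
def pat123 : Equiv.Perm (Fin 3) := 1
/-- The pattern 132. -/
def pat132 : Equiv.Perm (Fin 3) := Equiv.swap 1 2
/-- The pattern 213. -/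
def pat213 : Equiv.Perm (Fin 3) := Equiv.swap 0 1
/-- The pattern 231. -/
def pat231 : Equiv.Perm (Fin 3) := finRotate 3
/-- The pattern 312. -/
def pat312 : Equiv.Perm (Fin 3) := (finRotate 3)⁻¹
/-- The pattern 321. -/
def pat321 : Equiv.Perm (Fin 3) := Equiv.swap 0 2

/-- Mod-k-alternating: `π(i) ≡ i (mod k)` (1-based; equivalently 0-based). -/
def ModKAlt {n : ℕ} (k : ℕ) (π : Equiv.Perm (Fin n)) : Prop :=
  ∀ i : Fin n, (π i : ℕ) % k = (i : ℕ) % k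

/-- `π(i) ≡ r + i − 1 (mod k)` for all `i ∈ [n]` (1-based). -/
def ModKAltR {n : ℕ} (k r : ℕ) (π : Equiv.Perm (Fin n)) : Prop :=
  ∀ i : Fin n, ((π i : ℕ) + 1) % k = (r + (i : ℕ)) % k

/-- `mp_σ(n,k)`: number of mod-k-alternating permutations of `[n]` avoiding `σ`. -/
noncomputable def mpPat (k : ℕ) (σ : Equiv.Perm (Fin 3)) (n : ℕ) : ℕ :=
  Nat.card {π : Equiv.Perm (Fin n) // ModKAlt k π ∧ ¬ Pattern3 σ π}

/-- `mp_σ(n,k,r)`: number of permutations in `MP(n,k,r)` avoiding `σ`. -/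
noncomputable def mpPatR (k r : ℕ) (σ : Equiv.Perm (Fin 3)) (n : ℕ) : ℕ :=
  Nat.card {π : Equiv.Perm (Fin n) // ModKAltR k r π ∧ ¬ Pattern3 σ π}

/-- `mp_{σ,τ}(n,k)`: number of mod-k-alternating permutations of `[n]` avoiding both `σ` and `τ`. -/
noncomputable def mpPat2 (k : ℕ) (σ τ : Equiv.Perm (Fin 3)) (n : ℕ) : ℕ :=
  Nat.card {π : Equiv.Perm (Fin n) // ModKAlt k π ∧ ¬ Pattern3 σ π ∧ ¬ Pattern3 τ π}

/-- The revflip involution: `revflip(π)(i) = n + 1 − π(n + 1 − i)` (1-based). -/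
def revflip {n : ℕ} (π : Equiv.Perm (Fin n)) : Equiv.Perm (Fin n) :=
  (Fin.revPerm.trans π).trans Fin.revPerm

section Lists

/-- A word of natural numbers has no subword order-isomorphic to `213`. -/
def Avoids213 (l : List ℕ) : Prop :=
  l.Triplewise fun b a c => ¬(a < b ∧ b < c)

/-- The entries of the word have residues `c, c + 1, c + 2, …` modulo `k`. -/
def HasResidues {k : ℕ} (c : ZMod k) (l : List ℕ) : Prop :=
  ∀ i (h : i < l.length), ((l[i] : ℕ) : ZMod k) = c + (i : ZMod k)

theorem hasResidues_nil {k : ℕ} (c : ZMod k) : HasResidues c [] := by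
  simp [HasResidues]

theorem hasResidues_cons {k : ℕ} {c : ZMod k} {m : ℕ} {l : List ℕ} :
    HasResidues c (m :: l) ↔ (m : ZMod k) = c ∧ HasResidues (c + 1) l := by
  constructor
  · intro h
    refine ⟨h 0 (by simp) |>.trans (by simp), fun i hi => ?_⟩
    have := h (i + 1) (by simpa using hi)
    simp only [List.getElem_cons_succ] at this
    rw [this]; push_cast; ring
  · rintro ⟨h0, h⟩ i hi
    cases i with
    | zero => simpa using h0
    | succ i =>
      simp only [List.getElem_cons_succ]
      rw [h i (by simpa using hi)]; push_cast; ring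

theorem hasResidues_append {k : ℕ} {c : ZMod k} {l₁ l₂ : List ℕ} :
    HasResidues c (l₁ ++ l₂) ↔
      HasResidues c l₁ ∧ HasResidues (c + (l₁.length : ZMod k)) l₂ := by
  induction l₁ generalizing c with
  | nil => simp [hasResidues_nil]
  | cons m l ih =>
    have h : c + 1 + (l.length : ZMod k) = c + ((m :: l).length : ZMod k) := by
      simp only [List.length_cons]; push_cast; ring
    rw [List.cons_append, hasResidues_cons, hasResidues_cons, ih, h, and_assoc]

theorem hasResidues_map_add {k : ℕ} {c : ZMod k} {d : ℕ} {l : List ℕ} :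
    HasResidues (c + (d : ZMod k)) (l.map (· + d)) ↔ HasResidues c l := by
  simp only [HasResidues, List.length_map, List.getElem_map, Nat.cast_add]
  refine forall₂_congr fun i _ => ?_
  rw [add_right_comm, add_left_inj]

theorem avoids213_map_add {d : ℕ} {l : List ℕ} :
    Avoids213 (l.map (· + d)) ↔ Avoids213 l := by
  simp [Avoids213, List.triplewise_map]

theorem eq_filter_append_filter {m : ℕ} {t : List ℕ} (hm : m ∉ t)
    (ht : t.Pairwise fun a c => ¬(a < m ∧ m < c)) :
    t = t.filter (m < ·) ++ t.filter (· < m) := by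
  induction t with
  | nil => rfl
  | cons x t ih =>
    rw [List.pairwise_cons] at ht
    simp only [List.mem_cons, not_or] at hm
    have ih := ih hm.2 ht.2
    rcases lt_or_gt_of_ne hm.1 with h | h
    · rw [List.filter_cons_of_pos (by simpa using h),
        List.filter_cons_of_neg (by simpa using h.le), List.cons_append, ← ih]
    · have h0 : t.filter (m < ·) = [] := by
        rw [List.filter_eq_nil_iff]
        intro c hc
        have := ht.1 c hc
        simp only [decide_eq_true_eq]
        tauto
      rw [List.filter_cons_of_neg (by simpa using h.le),
        List.filter_cons_of_pos (by simpa using h), h0, List.nil_append]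
      rw [h0, List.nil_append] at ih
      rw [← ih]

theorem avoids213_cons_append {m : ℕ} {l₁ l₂ : List ℕ} (h₁ : ∀ x ∈ l₁, m < x)
    (h₂ : ∀ x ∈ l₂, x < m) :
    Avoids213 (m :: (l₁ ++ l₂)) ↔ Avoids213 l₁ ∧ Avoids213 l₂ := by
  simp only [Avoids213, List.triplewise_cons, List.triplewise_append, List.pairwise_append]
  constructor
  · rintro ⟨-, h, h', -⟩
    exact ⟨h, h'⟩
  · rintro ⟨h, h'⟩
    refine ⟨⟨?_, ?_, ?_⟩, h, h', ?_, ?_⟩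
    · exact List.pairwise_of_forall_mem_list fun a ha c _ => by have := h₁ a ha; lia
    · exact List.pairwise_of_forall_mem_list fun a _ c hc => by have := h₂ c hc; lia
    · intro a ha c hc
      have := h₁ a ha
      lia
    · exact fun b hb => List.pairwise_of_forall_mem_list fun a _ c hc => by
        have := h₂ c hc
        have := h₁ b hb
        lia
    · exact fun c hc => List.pairwise_of_forall_mem_list fun b hb a _ => by
        have := h₂ c hc
        have := h₁ b hb
        lia

open Classical in
/-- The `213`-avoiding arrangements of `0, …, n - 1` with residues `c, c + 1, …` modulo `k`. -/
noncomputable def avoiders213 {k : ℕ} (n : ℕ) (c : ZMod k) : Finset (List ℕ) :=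
  (List.range n).permutations.toFinset.filter fun l => Avoids213 l ∧ HasResidues c l

theorem perm_range_iff {l : List ℕ} {n : ℕ} :
    l.Perm (List.range n) ↔ l.Nodup ∧ ∀ x, x ∈ l ↔ x < n := by
  constructor
  · intro h
    exact ⟨h.nodup_iff.2 List.nodup_range, fun x => by rw [h.mem_iff, List.mem_range]⟩
  · rintro ⟨h, h'⟩
    rw [List.perm_ext_iff_of_nodup h List.nodup_range]
    simpa using h'

theorem mem_avoiders213 {k n : ℕ} {c : ZMod k} {l : List ℕ} :
    l ∈ avoiders213 n c ↔ (l.Nodup ∧ ∀ x, x ∈ l ↔ x < n) ∧ Avoids213 l ∧ HasResidues c l := by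
  simp [avoiders213, List.mem_permutations, perm_range_iff]

theorem length_of_mem_avoiders213 {k n : ℕ} {c : ZMod k} {l : List ℕ}
    (h : l ∈ avoiders213 n c) : l.length = n := by
  simpa using (perm_range_iff.2 (mem_avoiders213.1 h).1).length_eq

theorem card_avoiders213_zero {k : ℕ} (c : ZMod k) : (avoiders213 0 c).card = 1 := by
  rw [Finset.card_eq_one]
  refine ⟨[], Finset.ext fun l => ?_⟩
  rw [mem_avoiders213, Finset.mem_singleton]
  constructor
  · rintro ⟨⟨-, h⟩, -⟩
    exact List.eq_nil_iff_forall_not_mem.2 fun x hx => by simpa using (h x).1 hx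
  · rintro rfl
    exact ⟨by simp, List.Triplewise.nil, hasResidues_nil c⟩

/-- Put `m` first, then a copy of `L` shifted above `m`, then `S`. -/
def assemble (m : ℕ) (L S : List ℕ) : List ℕ :=
  m :: (L.map (· + (m + 1)) ++ S)

theorem assemble_mem_avoiders213 {k n m : ℕ} {L S : List ℕ} (hm : m ≤ n)
    (hL : L ∈ avoiders213 (n - m) (0 : ZMod k))
    (hS : S ∈ avoiders213 m ((n : ZMod k) + 1)) :
    assemble m L S ∈ avoiders213 (n + 1) (m : ZMod k) := by
  have hlen := length_of_mem_avoiders213 hL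
  rw [mem_avoiders213] at hL hS ⊢
  obtain ⟨⟨hL1, hL2⟩, hL3, hL4⟩ := hL
  obtain ⟨⟨hS1, hS2⟩, hS3, hS4⟩ := hS
  have hinj : Function.Injective (· + (m + 1) : ℕ → ℕ) := add_left_injective _
  have hL5 : ∀ x, x ∈ L.map (· + (m + 1)) ↔ m < x ∧ x < n + 1 := by
    intro x
    simp only [List.mem_map, hL2]
    constructor
    · rintro ⟨y, hy, rfl⟩
      lia
    · intro hx
      exact ⟨x - (m + 1), by lia, by lia⟩
  unfold assemble
  refine ⟨⟨?_, fun x => ?_⟩, ?_, ?_⟩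
  · simp only [List.nodup_cons, List.nodup_append, List.mem_append, hL5, hS2]
    exact ⟨by simp, hL1.map hinj, hS1, fun a ha b hb => by lia⟩
  · simp only [List.mem_cons, List.mem_append, hL5, hS2]
    lia
  · rw [avoids213_cons_append (fun x hx => ((hL5 x).1 hx).1) (fun x hx => (hS2 x).1 hx),
      avoids213_map_add]
    exact ⟨hL3, hS3⟩
  · rw [hasResidues_cons, hasResidues_append]
    refine ⟨rfl, ?_, ?_⟩
    · have := (hasResidues_map_add (d := m + 1)).2 hL4
      simpa using this
    · rw [List.length_map, hlen, Nat.cast_sub hm]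
      convert hS4 using 1
      ring

theorem assemble_injective {m m' : ℕ} {L L' S S' : List ℕ} (hlen : m = m' → L.length = L'.length)
    (h : assemble m L S = assemble m' L' S') : m = m' ∧ L = L' ∧ S = S' := by
  unfold assemble at h
  obtain ⟨rfl, h⟩ := List.cons_eq_cons.1 h
  obtain ⟨h1, h2⟩ := List.append_inj h (by simpa using hlen rfl)
  exact ⟨rfl, List.map_injective_iff.2 (add_left_injective _) h1, h2⟩

theorem exists_assemble_eq {k n : ℕ} {c : ZMod k} {l : List ℕ}
    (hl : l ∈ avoiders213 (n + 1) c) :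
    ∃ m ≤ n, (m : ZMod k) = c ∧ ∃ L ∈ avoiders213 (n - m) (0 : ZMod k),
      ∃ S ∈ avoiders213 m ((n : ZMod k) + 1), assemble m L S = l := by
  rw [mem_avoiders213] at hl
  obtain ⟨⟨hnd, hmem⟩, hav, hres⟩ := hl
  rcases l with _ | ⟨m, t⟩
  · simpa using (hmem 0).2 (by lia)
  have hmn : m ≤ n := by have := (hmem m).1 (by simp); lia
  rw [List.nodup_cons] at hnd
  have htmem : ∀ x, x ∈ t ↔ x < n + 1 ∧ x ≠ m := by
    intro x
    rw [← hmem, List.mem_cons]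
    constructor
    · intro hx
      exact ⟨Or.inr hx, fun h => hnd.1 (h ▸ hx)⟩
    · tauto
  have hsplit := eq_filter_append_filter hnd.1 (List.triplewise_cons.1 hav).1
  set U := t.filter (m < ·) with hU
  set S := t.filter (· < m) with hS
  set L := U.map (· - (m + 1)) with hL
  have hUmem : ∀ x, x ∈ U ↔ m < x ∧ x < n + 1 := by
    intro x
    simp only [hU, List.mem_filter, htmem, decide_eq_true_eq]
    lia
  have hSmem : ∀ x, x ∈ S ↔ x < m := by
    intro x
    simp only [hS, List.mem_filter, htmem, decide_eq_true_eq]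
    lia
  have hUL : L.map (· + (m + 1)) = U := by
    rw [hL, List.map_map]
    conv_rhs => rw [← List.map_id U]
    refine List.map_congr_left fun x hx => ?_
    have := (hUmem x).1 hx
    simp only [Function.comp_apply, id]
    lia
  have hav' : Avoids213 (m :: (U ++ S)) := hsplit ▸ hav
  rw [avoids213_cons_append (fun x hx => ((hUmem x).1 hx).1) (fun x hx => (hSmem x).1 hx),
    ← hUL, avoids213_map_add] at hav'
  have hres' : HasResidues c (m :: (U ++ S)) := hsplit ▸ hres
  rw [hasResidues_cons, hasResidues_append, ← hUL] at hres'
  obtain ⟨rfl, hr1, hr2⟩ := hres'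
  have hLin : L ∈ avoiders213 (n - m) (0 : ZMod k) := by
    rw [mem_avoiders213]
    refine ⟨⟨?_, fun x => ?_⟩, hav'.1, ?_⟩
    · have : (L.map (· + (m + 1))).Nodup := hUL ▸ hnd.2.filter _
      exact this.of_map
    · simp only [hL, List.mem_map, hUmem]
      constructor
      · rintro ⟨y, hy, rfl⟩
        lia
      · intro hx
        exact ⟨x + (m + 1), by lia, by lia⟩
    · rw [← hasResidues_map_add (d := m + 1)]
      simpa using hr1
  refine ⟨m, hmn, rfl, L, hLin, S, ?_, ?_⟩
  · rw [mem_avoiders213]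
    refine ⟨⟨hnd.2.filter _, hSmem⟩, hav'.2, ?_⟩
    rw [List.length_map, length_of_mem_avoiders213 hLin, Nat.cast_sub hmn] at hr2
    convert hr2 using 1
    ring
  · rw [assemble, hUL, ← hsplit]

theorem card_avoiders213_succ {k : ℕ} (n : ℕ) (c : ZMod k) :
    (avoiders213 (n + 1) c).card = ∑ m ∈ Finset.range (n + 1) with ((m : ℕ) : ZMod k) = c,
      (avoiders213 (n - m) (0 : ZMod k)).card * (avoiders213 m ((n : ZMod k) + 1)).card := by
  simp_rw [← Finset.card_product]
  rw [← Finset.card_sigma]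
  symm
  refine Finset.card_bij (fun p _ => assemble p.1 p.2.1 p.2.2) ?_ ?_ ?_
  · rintro ⟨m, L, S⟩ h
    simp only [Finset.mem_sigma, Finset.mem_filter, Finset.mem_range, Finset.mem_product] at h
    obtain ⟨⟨hm, rfl⟩, hL, hS⟩ := h
    exact assemble_mem_avoiders213 (by lia) hL hS
  · rintro ⟨m, L, S⟩ h ⟨m', L', S'⟩ h' heq
    simp only [Finset.mem_sigma, Finset.mem_product] at h h'
    obtain ⟨rfl, rfl, rfl⟩ := assemble_injective (by
      rintro rfl
      rw [length_of_mem_avoiders213 h.2.1, length_of_mem_avoiders213 h'.2.1]) heq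
    rfl
  · intro l hl
    obtain ⟨m, hm, hc, L, hL, S, hS, rfl⟩ := exists_assemble_eq hl
    refine ⟨⟨m, L, S⟩, ?_, rfl⟩
    simp only [Finset.mem_sigma, Finset.mem_filter, Finset.mem_range, Finset.mem_product]
    exact ⟨⟨by lia, hc⟩, hL, hS⟩

end Lists

section Recurrence

open PowerSeries

/-- The part of the generating function of `a` supported on exponents `≡ s` modulo `k`. -/
noncomputable def residueSeries (k : ℕ) (a : ℕ → ℕ) (s : ℕ) : PowerSeries ℕ :=
  PowerSeries.mk fun n => if n % k = s then a n else 0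

variable {k : ℕ} {a : ℕ → ℕ}

theorem residueSeries_succ
    (harec : ∀ n : ℕ,
      a (n + 1) = ∑ i ∈ Finset.range (n + 1), if k ∣ i then a i * a (n - i) else 0)
    {s : ℕ} (hs : s + 1 < k) :
    residueSeries k a (s + 1) = X * (residueSeries k a 0 * residueSeries k a s) := by
  ext n
  cases n with
  | zero => simp [residueSeries]
  | succ n =>
    rw [coeff_succ_X_mul, coeff_mul, Finset.Nat.sum_antidiagonal_eq_sum_range_succ_mk]
    simp only [residueSeries, coeff_mk]
    have hmod : (n + 1) % k = s + 1 ↔ n % k = s := by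
      rw [Nat.add_mod, Nat.mod_eq_of_lt (show 1 < k by lia)]
      have := Nat.mod_lt n (show 0 < k by lia)
      rcases (show n % k + 1 < k ∨ n % k + 1 = k by lia) with h | h
      · rw [Nat.mod_eq_of_lt h]; lia
      · rw [h, Nat.mod_self]; lia
    have hterm : ∀ i ∈ Finset.range (n + 1),
        ((if i % k = 0 then a i else 0) * if (n - i) % k = s then a (n - i) else 0) =
          if n % k = s then (if k ∣ i then a i * a (n - i) else 0) else 0 := by
      intro i hi
      by_cases hki : k ∣ i
      · have h : (n - i) % k = n % k := by
          obtain ⟨q, rfl⟩ := hki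
          exact Nat.sub_mul_mod (by simpa [Nat.lt_succ_iff] using hi)
        simp [hki, Nat.mod_eq_zero_of_dvd hki, h]
      · simp [hki, mt Nat.dvd_of_mod_eq_zero hki]
    rw [Finset.sum_congr rfl hterm]
    simp only [hmod]
    split_ifs with h
    · exact harec n
    · simp

theorem residueSeries_eq
    (harec : ∀ n : ℕ,
      a (n + 1) = ∑ i ∈ Finset.range (n + 1), if k ∣ i then a i * a (n - i) else 0)
    {s : ℕ} (hs : s < k) :
    residueSeries k a s = X ^ s * residueSeries k a 0 ^ (s + 1) := by
  induction s with
  | zero => simp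
  | succ s ih =>
    rw [residueSeries_succ harec hs, ih (by lia)]
    ring

theorem sum_residue_eq
    (harec : ∀ n : ℕ,
      a (n + 1) = ∑ i ∈ Finset.range (n + 1), if k ∣ i then a i * a (n - i) else 0)
    {s n : ℕ} (hs : s < k) (hn : k ∣ n + 1) :
    ∑ i ∈ Finset.range (n + 1) with i % k = s, a (n - i) * a i = a (n + 1) := by
  have key : ∀ t < k, coeff n (residueSeries k a t * residueSeries k a (k - 1 - t)) =
      ∑ i ∈ Finset.range (n + 1) with i % k = t, a (n - i) * a i := by
    intro t ht
    rw [coeff_mul, Finset.Nat.sum_antidiagonal_eq_sum_range_succ_mk, Finset.sum_filter]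
    refine Finset.sum_congr rfl fun i hi => ?_
    simp only [residueSeries, coeff_mk]
    split_ifs with h1 h2
    · ring
    · refine absurd ?_ h2
      have hi := Finset.mem_range.1 hi
      have h3 : n - i + i + 1 = n + 1 := by lia
      obtain ⟨q, hq⟩ := hn
      have h4 := Nat.div_add_mod i k
      have h5 : n - i = (k - 1 - t) + k * (q - 1 - i / k) := by
        have h6 : i / k + 1 ≤ q := by
          have : k * (i / k) < k * q := by lia
          exact Nat.lt_of_mul_lt_mul_left this
        obtain ⟨e, rfl⟩ := Nat.exists_eq_add_of_le h6
        have : i / k + 1 + e - 1 - i / k = e := by lia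
        rw [this]
        ring_nf at hq ⊢
        lia
      rw [h5, Nat.add_mul_mod_self_left, Nat.mod_eq_of_lt (by lia)]
    · simp
    · simp
  have hprod : ∀ t < k, residueSeries k a t * residueSeries k a (k - 1 - t) =
      X ^ (k - 1) * residueSeries k a 0 ^ (k + 1) := by
    intro t ht
    rw [residueSeries_eq harec ht, residueSeries_eq harec (show k - 1 - t < k by lia),
      mul_mul_mul_comm, ← pow_add, ← pow_add]
    congr 2 <;> lia
  have h0 : 0 < k := by lia
  rw [← key s hs, hprod s hs, ← hprod 0 h0, key 0 h0, harec, Finset.sum_filter]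
  refine Finset.sum_congr rfl fun i _ => ?_
  simp only [Nat.dvd_iff_mod_eq_zero, mul_comm]

theorem card_avoiders213 (hk : 0 < k) (ha0 : a 0 = 1)
    (harec : ∀ n : ℕ,
      a (n + 1) = ∑ i ∈ Finset.range (n + 1), if k ∣ i then a i * a (n - i) else 0)
    (n : ℕ) (c : ZMod k) :
    (avoiders213 n c).card = if c = 0 ∨ k ∣ n then a n else 0 := by
  have : NeZero k := ⟨hk.ne'⟩
  induction n using Nat.strong_induction_on generalizing c with
  | _ n ih =>
  rcases n with _ | n
  · simp [card_avoiders213_zero, ha0]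
  have hres : ∀ m : ℕ, (m : ZMod k) = c ↔ m % k = c.val := by
    intro m
    rw [← ZMod.val_natCast, (ZMod.val_injective k).eq_iff]
  rw [card_avoiders213_succ]
  by_cases hn : k ∣ n + 1
  · rw [if_pos (Or.inr hn), ← sum_residue_eq harec (ZMod.val_lt c) hn]
    simp only [hres]
    refine Finset.sum_congr rfl fun m hm => ?_
    simp only [Finset.mem_filter, Finset.mem_range] at hm
    have hn' : (n : ZMod k) + 1 = 0 := by
      exact_mod_cast (ZMod.natCast_eq_zero_iff (n + 1) k).2 hn
    rw [ih _ (by lia), ih _ (by lia), if_pos (Or.inl rfl), if_pos (Or.inl hn')]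
  · have hn' : (n : ZMod k) + 1 ≠ 0 := fun h =>
      hn ((ZMod.natCast_eq_zero_iff (n + 1) k).1 (by exact_mod_cast h))
    by_cases hc : c = 0
    · subst hc
      rw [if_pos (Or.inl rfl), harec, Finset.sum_filter]
      refine Finset.sum_congr rfl fun m hm => ?_
      simp only [Finset.mem_range] at hm
      simp only [ZMod.natCast_eq_zero_iff]
      split_ifs with hkm
      · rw [ih _ (by lia), ih _ (by lia), if_pos (Or.inl rfl), if_pos (Or.inr hkm), mul_comm]
      · rfl
    · rw [if_neg (by tauto)]
      refine Finset.sum_eq_zero fun m hm => ?_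
      simp only [Finset.mem_filter, Finset.mem_range] at hm
      have hkm : ¬ k ∣ m := fun h => hc (hm.2 ▸ (ZMod.natCast_eq_zero_iff m k).2 h)
      rw [ih m (by lia), if_neg (by tauto), mul_zero]

end Recurrence

theorem pattern3_pat213_iff {n : ℕ} (π : Equiv.Perm (Fin n)) :
    Pattern3 pat213 π ↔ ∃ i j l : Fin n, i < j ∧ j < l ∧ π j < π i ∧ π i < π l := by
  constructor
  · rintro ⟨f, hf, h⟩
    exact ⟨f 0, f 1, f 2, hf (by decide), hf (by decide), (h 1 0).1 (by decide),
      (h 0 2).1 (by decide)⟩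
  · rintro ⟨i, j, l, hij, hjl, h1, h2⟩
    refine ⟨![i, j, l], ?_, ?_⟩
    · intro x y hxy
      fin_cases x <;> fin_cases y <;> simp_all
      exact hij.trans hjl
    · have e0 : pat213 0 = 1 := by decide
      have e1 : pat213 1 = 0 := by decide
      have e2 : pat213 2 = 2 := by decide
      have h3 := h1.trans h2
      intro x y
      fin_cases x <;> fin_cases y <;> simp [e0, e1, e2, h1, h2, h3, h1.le, h2.le, h3.le]

/-- The word `π 0, π 1, …` of a permutation of `Fin n`. -/
def permWord {n : ℕ} (π : Equiv.Perm (Fin n)) : List ℕ :=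
  List.ofFn fun i => (π i : ℕ)

theorem avoids213_permWord {n : ℕ} (π : Equiv.Perm (Fin n)) :
    Avoids213 (permWord π) ↔ ¬ Pattern3 pat213 π := by
  rw [pattern3_pat213_iff, Avoids213, List.triplewise_iff_getElem]
  simp only [permWord, List.getElem_ofFn, List.length_ofFn]
  constructor
  · rintro h ⟨i, j, l, hij, hjl, h1, h2⟩
    exact h i j l hij hjl l.2 ⟨h1, h2⟩
  · rintro h i j l hij hjl hl ⟨h1, h2⟩
    exact h ⟨⟨i, by lia⟩, ⟨j, by lia⟩, ⟨l, hl⟩, hij, hjl, h1, h2⟩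

theorem hasResidues_permWord {n k r : ℕ} (hr : 1 ≤ r) (π : Equiv.Perm (Fin n)) :
    HasResidues ((r - 1 : ℕ) : ZMod k) (permWord π) ↔ ModKAltR k r π := by
  simp only [HasResidues, ModKAltR, permWord, List.getElem_ofFn, List.length_ofFn]
  rw [Fin.forall_iff]
  refine forall₂_congr fun i hi => ?_
  rw [← ZMod.natCast_eq_natCast_iff', ← Nat.cast_add, ← add_left_inj (1 : ZMod k)]
  have : r + i = r - 1 + i + 1 := by lia
  rw [this]
  push_cast
  rfl

theorem permWord_injective {n : ℕ} :
    Function.Injective (permWord : Equiv.Perm (Fin n) → List ℕ) := by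
  intro π τ h
  ext i
  exact congrFun (List.ofFn_injective h) i

theorem mem_range_permWord {n : ℕ} {l : List ℕ} :
    (∃ π : Equiv.Perm (Fin n), permWord π = l) ↔ l.Nodup ∧ ∀ x, x ∈ l ↔ x < n := by
  constructor
  · rintro ⟨π, rfl⟩
    refine ⟨List.nodup_ofFn.2 (Fin.val_injective.comp π.injective), fun x => ?_⟩
    simp only [permWord, List.mem_ofFn]
    constructor
    · rintro ⟨i, rfl⟩
      exact (π i).2
    · intro hx
      exact ⟨π.symm ⟨x, hx⟩, by simp⟩
  · intro h
    obtain rfl : l.length = n := by simpa using (perm_range_iff.2 h).length_eq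
    let f : Fin l.length → Fin l.length := fun i => ⟨l[i], (h.2 _).1 (List.getElem_mem _)⟩
    have hf : Function.Injective f := by
      intro i j hij
      exact Fin.ext ((h.1.getElem_inj_iff).1 (Fin.mk.inj_iff.1 hij))
    refine ⟨Equiv.ofBijective f (Finite.injective_iff_bijective.1 hf), ?_⟩
    simp [permWord, f]

theorem mpPatR_pat213_eq_card {n k r : ℕ} (hr : 1 ≤ r) :
    mpPatR k r pat213 n = (avoiders213 n ((r - 1 : ℕ) : ZMod k)).card := by
  rw [mpPatR, ← Nat.card_eq_finsetCard]
  refine Nat.card_congr (Equiv.ofBijective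
    (fun π => ⟨permWord π.1, mem_avoiders213.2 ⟨mem_range_permWord.1 ⟨π.1, rfl⟩,
      (avoids213_permWord _).2 π.2.2, (hasResidues_permWord hr _).2 π.2.1⟩⟩) ⟨?_, ?_⟩)
  · intro π τ h
    exact Subtype.ext (permWord_injective (Subtype.mk.inj h))
  · rintro ⟨l, hl⟩
    obtain ⟨hl1, hl2, hl3⟩ := mem_avoiders213.1 hl
    obtain ⟨π, rfl⟩ := mem_range_permWord.2 hl1
    exact ⟨⟨π, (hasResidues_permWord hr _).1 hl3, (avoids213_permWord _).1 hl2⟩, rfl⟩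

theorem mp213_with_remainder (k n r : ℕ) (hk : 3 ≤ k) (hn : 1 ≤ n)
    (hr1 : 1 ≤ r) (hrk : r ≤ k) (a : ℕ → ℕ) (ha0 : a 0 = 1)
    (harec : ∀ n : ℕ,
      a (n + 1) = ∑ i ∈ Finset.range (n + 1), if k ∣ i then a i * a (n - i) else 0) :
    mpPatR k r pat213 n = if r = 1 ∨ k ∣ n then a n else 0 := by
  have hr : ((r - 1 : ℕ) : ZMod k) = 0 ↔ r = 1 := by
    rw [ZMod.natCast_eq_zero_iff, Nat.dvd_iff_mod_eq_zero, Nat.mod_eq_of_lt (by lia)]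
    lia
  rw [mpPatR_pat213_eq_card hr1, card_avoiders213 (by lia) ha0 harec]
  simp only [hr]
end
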